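/- arXiv:1512.06026 — 6 statements merged into one kernel-verified Lean document; each statement's English description precedes it below -/
import Mathlib

section
/- Let k ≥ 3 be an integer and a_1, …, a_k be real numbers. For every real number M there exists a real number ℓ < 0 such that the polynomial ∏_{i=1}^{k}(X − a_i) − ℓ has a complex root r with Re r > M. That is, for simple k-cycles of length at least 3 with negative loop gain, the root locus has an asymptote entering the open right half of the complex plane. -/
open Polynomial

lemma factor_polar (c y : ℝ) (hc : 0 < c) :
    ((c : ℂ) + y * Complex.I) = (‖(c : ℂ) + y * Complex.I‖ : ℂ) *
      Complex.exp ((Real.arctan (y / c) : ℝ) * Complex.I) := by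
  have hre : ((c : ℂ) + y * Complex.I).re = c := by simp
  have him : ((c : ℂ) + y * Complex.I).im = y := by simp
  have h := Complex.abs_arg_lt_pi_div_two_iff.2
    (Or.inl (by rw [hre]; exact hc) : 0 < ((c : ℂ) + y * Complex.I).re ∨ _)
  have h2 : Real.arctan (y / c) = Complex.arg ((c : ℂ) + y * Complex.I) := by
    have h3 := Complex.tan_arg ((c : ℂ) + y * Complex.I)
    rw [hre, him] at h3
    rw [← h3]
    exact Real.arctan_tan (abs_lt.1 h).1 (abs_lt.1 h).2
  rw [h2, Complex.norm_mul_exp_arg_mul_I]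

/-- For `k ≥ 3` and any diagonal entries `a 1, …, a k` and any bound `M`, there is a
negative loop gain `ℓ` such that `∏ i (X - a i) - ℓ` has a complex root `r` with
`Re r > M`: the root locus of a simple `k`-cycle with negative gain has an asymptote
entering the open right half-plane. -/
theorem exists_root_large_re_neg_gain (k : ℕ) (hk : 3 ≤ k) (a : Fin k → ℝ) (M : ℝ) :
    ∃ ℓ : ℝ, ℓ < 0 ∧ ∃ r : ℂ, M < r.re ∧
      (((∏ i : Fin k, (X - C (a i))) - C ℓ).map (algebraMap ℝ ℂ)).IsRoot r := by
  obtain ⟨x, hxM, hc⟩ : ∃ x : ℝ, M < x ∧ ∀ i, 0 < x - a i := by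
    refine ⟨|M| + ∑ i, |a i| + 1, ?_, fun i => ?_⟩
    · have : 0 ≤ ∑ i, |a i| := Finset.sum_nonneg fun i _ => abs_nonneg _
      linarith [le_abs_self M]
    · have := Finset.single_le_sum (f := fun i => |a i|) (fun i _ => abs_nonneg _)
        (Finset.mem_univ i)
      linarith [le_abs_self (a i), abs_nonneg M]
  set S := ∑ i, (x - a i) with hS
  have hcS : ∀ i, x - a i ≤ S := fun i =>
    Finset.single_le_sum (f := fun i => x - a i) (fun i _ => (hc i).le) (Finset.mem_univ i)
  have hS0 : 0 ≤ S := Finset.sum_nonneg fun i _ => (hc i).le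
  let f : ℝ → ℝ := fun y => ∑ i, Real.arctan (y / (x - a i))
  have hf : Continuous f := by
    refine continuous_finsetSum _ fun i _ => Real.continuous_arctan.comp ?_
    exact continuous_id.div_const _
  have hf0 : f 0 = 0 := by simp [f]
  have hf1 : Real.pi ≤ f (√3 * S) := by
    have h1 : ∀ i ∈ (Finset.univ : Finset (Fin k)),
        Real.pi / 3 ≤ Real.arctan (√3 * S / (x - a i)) := by
      intro i _
      rw [← Real.arctan_sqrt_three]
      apply Real.arctan_strictMono.monotone
      rw [le_div_iff₀ (hc i)]
      exact mul_le_mul_of_nonneg_left (hcS i) (Real.sqrt_nonneg _)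
    have h2 := Finset.sum_le_sum h1
    simp only [Finset.sum_const, Finset.card_univ, Fintype.card_fin, nsmul_eq_mul] at h2
    have h3 : (3 : ℝ) ≤ k := by exact_mod_cast hk
    have h4 := Real.pi_pos
    refine le_trans ?_ h2
    nlinarith
  obtain ⟨y, -, hy⟩ := intermediate_value_Icc (by positivity : (0 : ℝ) ≤ √3 * S) hf.continuousOn
    (show Real.pi ∈ Set.Icc (f 0) (f (√3 * S)) from ⟨by rw [hf0]; exact Real.pi_pos.le, hf1⟩)
  refine ⟨-∏ i, ‖((x - a i : ℝ) : ℂ) + y * Complex.I‖, ?_, x + y * Complex.I, by simpa using hxM, ?_⟩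
  · rw [neg_lt_zero]
    refine Finset.prod_pos fun i _ => norm_pos_iff.2 fun h => ?_
    have := congrArg Complex.re h
    simp at this
    have := hc i
    linarith
  · have key : ∏ i, (((x - a i : ℝ) : ℂ) + y * Complex.I)
        = -∏ i, (‖((x - a i : ℝ) : ℂ) + y * Complex.I‖ : ℂ) := by
      rw [Finset.prod_congr rfl fun i _ => factor_polar (x - a i) y (hc i),
        Finset.prod_mul_distrib, ← Complex.exp_sum, ← Finset.sum_mul, ← Complex.ofReal_sum]
      change _ * Complex.exp (((f y : ℝ) : ℂ) * Complex.I) = _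
      rw [hy, Complex.exp_pi_mul_I, mul_neg_one]
    rw [IsRoot.def, eval_map_algebraMap, map_sub, map_prod]
    simp only [map_sub, aeval_X, aeval_C, Complex.coe_algebraMap]
    rw [sub_eq_zero, Complex.ofReal_neg, Complex.ofReal_prod, ← key]
    refine Finset.prod_congr rfl fun i _ => ?_
    push_cast
    ring
end

section
/- Let k ≥ 3 be an integer, let a_1, …, a_k be arbitrary real numbers, and let c_1, …, c_k be nonzero real numbers. Then there exists a real t > 0 such that the k×k simple k-cycle matrix with diagonal entries a_1, …, a_k, subdiagonal entries t·c_1, …, t·c_{k−1}, and corner entry t·c_k has an eigenvalue (complex root of its characteristic polynomial) with strictly positive real part. In particular, no sign pattern containing a simple cycle of length k ≥ 3 with all cycle entries nonzero is sign stable. -/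
open Polynomial

/-- The simple `k`-cycle matrix with diagonal entries `a i`, subdiagonal entries
`A (i+1) i = c i` for `i = 0, …, k-2`, and corner entry `A 0 (k-1) = c (k-1)`. -/
def simpleCycleMatrix (k : ℕ) (a c : Fin k → ℝ) : Matrix (Fin k) (Fin k) ℝ :=
  Matrix.of fun i j => if i = j then a i else if (i : ℕ) = ((j : ℕ) + 1) % k then c j else 0

theorem aux_multiset (s : Multiset ℂ) (h : ∀ z ∈ s, z.re ≤ 0) :
    s.sum.re ≤ 0 ∧
    (s.map (fun z => Complex.normSq z)).sum ≤ 2 * s.sum.re ^ 2 - (s.map (fun z => z ^ 2)).sum.re ∧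
    Complex.normSq s.prod ≤ Real.exp ((s.map (fun z => Complex.normSq z)).sum) := by
  induction s using Multiset.induction_on with
  | empty => simp
  | cons x s ih =>
    obtain ⟨h1, h2, h3⟩ := ih (fun z hz => h z (Multiset.mem_cons_of_mem hz))
    have hx := h x (Multiset.mem_cons_self x s)
    simp only [Multiset.sum_cons, Multiset.map_cons, Multiset.prod_cons, Complex.add_re]
    refine ⟨by linarith, ?_, ?_⟩
    · have e1 : Complex.normSq x = 2 * x.re ^ 2 - (x ^ 2).re := by
        rw [Complex.normSq_apply, sq x, Complex.mul_re]; ring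
      nlinarith [mul_nonneg_of_nonpos_of_nonpos hx h1]
    · rw [Complex.normSq_mul, Real.exp_add]
      refine mul_le_mul ?_ h3 (Complex.normSq_nonneg _) (Real.exp_pos _).le
      linarith [Real.add_one_le_exp (Complex.normSq x)]

theorem aux_eval {n : ℕ} (A : Matrix (Fin n) (Fin n) ℂ) (z : ℂ) :
    A.charpoly.eval z = (A.charpoly.roots.map (fun l => z - l)).prod := by
  conv_lhs => rw [(IsAlgClosed.splits A.charpoly).eq_prod_roots_of_monic A.charpoly_monic]
  rw [Polynomial.eval_multiset_prod, Multiset.map_map]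
  simp

theorem aux_trace_sq {n : ℕ} (A : Matrix (Fin n) (Fin n) ℂ) :
    (A * A).trace = (A.charpoly.roots.map (fun z => z ^ 2)).sum := by
  have key : (A * A).charpoly =
      ((A.charpoly.roots.map (fun z => z ^ 2)).map (fun z => X - C z)).prod := by
    apply Polynomial.funext
    intro w
    obtain ⟨z, rfl⟩ := IsAlgClosed.exists_pow_nat_eq w (n := 2) (by norm_num)
    have hcard : Multiset.card A.charpoly.roots = n := by
      rw [← (IsAlgClosed.splits A.charpoly).natDegree_eq_card_roots]; simp
    have h1 : (A * A).charpoly.eval (z ^ 2) =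
        A.charpoly.eval z * ((-1) ^ n * A.charpoly.eval (-z)) := by
      rw [Matrix.eval_charpoly, Matrix.eval_charpoly, Matrix.eval_charpoly]
      have : Matrix.scalar (Fin n) (z ^ 2) - A * A =
          (Matrix.scalar (Fin n) z - A) * -(Matrix.scalar (Fin n) (-z) - A) := by
        have hcomm : A * Matrix.scalar (Fin n) z = Matrix.scalar (Fin n) z * A :=
          ((Matrix.scalar_commute z (fun r => mul_comm _ _) A).eq).symm
        rw [map_neg, map_pow, sq]
        simp only [neg_sub, sub_neg_eq_add, mul_add, sub_mul, add_mul, mul_sub, hcomm]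
        abel
      rw [this, Matrix.det_mul, Matrix.det_neg]
      simp
    rw [h1, aux_eval, aux_eval, Polynomial.eval_multiset_prod, Multiset.map_map, Multiset.map_map]
    have h2 : ((-1 : ℂ)) ^ n = (A.charpoly.roots.map (fun _ => (-1 : ℂ))).prod := by
      simp [hcard]
    rw [h2, ← Multiset.prod_map_mul, ← Multiset.prod_map_mul]
    congr 1
    apply Multiset.map_congr rfl
    intro l _
    simp
    ring
  rw [Matrix.trace_eq_sum_roots_charpoly, key, Polynomial.roots_multiset_prod_X_sub_C]

theorem aux_bound {n : ℕ} (A : Matrix (Fin n) (Fin n) ℝ)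
    (h : ∀ z : ℂ, (A.charpoly.map (algebraMap ℝ ℂ)).IsRoot z → z.re ≤ 0) :
    A.det ^ 2 ≤ Real.exp (2 * A.trace ^ 2 - (A * A).trace) := by
  set B : Matrix (Fin n) (Fin n) ℂ := A.map (algebraMap ℝ ℂ) with hB
  have hcp : B.charpoly = A.charpoly.map (algebraMap ℝ ℂ) := Matrix.charpoly_map A _
  have h' : ∀ z ∈ B.charpoly.roots, z.re ≤ 0 := by
    intro z hz
    apply h
    rw [← hcp]
    exact Polynomial.isRoot_of_mem_roots hz
  obtain ⟨-, h2, h3⟩ := aux_multiset _ h'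
  have hdet : B.det = (A.det : ℂ) := by
    rw [hB]; exact ((algebraMap ℝ ℂ).map_det A).symm
  have htr : B.trace = (A.trace : ℂ) := by
    simp [hB, Matrix.trace]
  have htr2 : (B * B).trace = ((A * A).trace : ℂ) := by
    rw [hB, ← Matrix.map_mul]; simp [Matrix.trace]
  rw [← Matrix.trace_eq_sum_roots_charpoly, ← aux_trace_sq, htr, htr2] at h2
  rw [← Matrix.det_eq_prod_roots_charpoly, hdet, Complex.normSq_ofReal, ← sq] at h3
  simp only [Complex.ofReal_re] at h2
  exact h3.trans (Real.exp_le_exp.2 h2)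

theorem aux_tr (k : ℕ) (a c : Fin k → ℝ) : (simpleCycleMatrix k a c).trace = ∑ i, a i := by
  simp [Matrix.trace, simpleCycleMatrix]

theorem aux_tr2 (k : ℕ) (hk : 3 ≤ k) (a c : Fin k → ℝ) :
    (simpleCycleMatrix k a c * simpleCycleMatrix k a c).trace = ∑ i, a i ^ 2 := by
  simp only [Matrix.trace, Matrix.diag, Matrix.mul_apply]
  refine Finset.sum_congr rfl fun i _ => ?_
  rw [Finset.sum_eq_single i]
  · simp [simpleCycleMatrix, sq]
  · intro j _ hj
    simp only [simpleCycleMatrix, Matrix.of_apply, if_neg hj, if_neg hj.symm]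
    by_cases h1 : (i : ℕ) = ((j : ℕ) + 1) % k
    · have h2 : ¬ (j : ℕ) = ((i : ℕ) + 1) % k := by
        intro h2
        have hi := i.2
        have hj := j.2
        rcases Nat.lt_or_ge (j + 1) k with h | h
        · rw [Nat.mod_eq_of_lt h] at h1
          rcases Nat.lt_or_ge (i + 1) k with h' | h'
          · rw [Nat.mod_eq_of_lt h'] at h2; omega
          · have : (i : ℕ) + 1 = k := by omega
            rw [this, Nat.mod_self] at h2; omega
        · have : (j : ℕ) + 1 = k := by omega
          rw [this, Nat.mod_self] at h1
          rw [h1, Nat.mod_eq_of_lt (by omega)] at h2; omega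
      rw [if_neg h2, mul_zero]
    · rw [if_neg h1, zero_mul]
  · simp

theorem aux_det0 (k : ℕ) (hk : 3 ≤ k) (c : Fin k → ℝ) (hc : ∀ i, c i ≠ 0) :
    (simpleCycleMatrix k (fun _ => 0) c).det ≠ 0 := by
  obtain ⟨m, rfl⟩ : ∃ m, k = m + 1 := ⟨k - 1, by omega⟩
  have : simpleCycleMatrix (m + 1) (fun _ => 0) c =
      Matrix.of fun i j => c j * (Equiv.Perm.permMatrix ℝ (finRotate (m + 1)).symm) i j := by
    ext i j
    have e : (i : ℕ) = ((j : ℕ) + 1) % (m + 1) ↔ (finRotate (m + 1)).symm i = j := by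
      rw [Equiv.symm_apply_eq, finRotate_succ_apply, Fin.ext_iff, Fin.val_add]
      simp
    have e2 : i = j → ¬ (i : ℕ) = ((j : ℕ) + 1) % (m + 1) := by
      rintro rfl h
      have hi := i.2
      rcases Nat.lt_or_ge (i + 1) (m + 1) with h' | h'
      · rw [Nat.mod_eq_of_lt h'] at h; omega
      · have : (i : ℕ) + 1 = m + 1 := by omega
        rw [this, Nat.mod_self] at h; omega
    simp only [simpleCycleMatrix, Matrix.of_apply, Equiv.Perm.permMatrix, PEquiv.toMatrix_apply,
      Equiv.toPEquiv_apply, Option.mem_def, Option.some.injEq, ← e]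
    by_cases hij : i = j
    · rw [if_pos hij, if_neg (e2 hij), mul_zero]
    · rw [if_neg hij]; simp
  rw [this, Matrix.det_mul_row, Matrix.det_permutation]
  refine mul_ne_zero (Finset.prod_ne_zero_iff.2 fun i _ => hc i) ?_
  rcases Int.units_eq_one_or (Equiv.Perm.sign (finRotate (m + 1)).symm) with h | h <;> simp [h]

/-- For `k ≥ 3`, arbitrary diagonal entries and nonzero cycle entries, some positive
rescaling `t` of the cycle entries (which preserves the sign pattern) produces a simple
`k`-cycle matrix with an eigenvalue of strictly positive real part.  Hence no sign
pattern containing a simple cycle of length `k ≥ 3` is sign stable. -/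
theorem simple_cycle_not_sign_stable (k : ℕ) (hk : 3 ≤ k) (a c : Fin k → ℝ)
    (hc : ∀ i, c i ≠ 0) :
    ∃ t : ℝ, 0 < t ∧ ∃ z : ℂ, 0 < z.re ∧
      ((simpleCycleMatrix k a (fun i => t * c i)).charpoly.map (algebraMap ℝ ℂ)).IsRoot z := by
  by_contra hcon
  have hb : ∀ t : ℝ, 0 < t → (simpleCycleMatrix k a (fun i => t * c i)).det ^ 2 ≤
      Real.exp (2 * (∑ i, a i) ^ 2 - ∑ i, a i ^ 2) := by
    intro t ht
    have := aux_bound (simpleCycleMatrix k a (fun i => t * c i)) (fun z hz => by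
      by_contra hz'
      exact hcon ⟨t, ht, z, not_le.1 hz', hz⟩)
    rwa [aux_tr, aux_tr2 k hk] at this
  set M := Real.exp (2 * (∑ i, a i) ^ 2 - ∑ i, a i ^ 2)
  have hN : ∀ e : ℝ, 0 < e →
      (simpleCycleMatrix k (fun i => e * a i) c).det ^ 2 ≤ (e ^ k) ^ 2 * M := by
    intro e he
    have h1 : simpleCycleMatrix k (fun i => e * a i) c =
        e • simpleCycleMatrix k a (fun i => e⁻¹ * c i) := by
      ext i j
      simp only [simpleCycleMatrix, Matrix.of_apply, Matrix.smul_apply, smul_eq_mul]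
      split_ifs <;> field_simp
      simp
    rw [h1, Matrix.det_smul, Fintype.card_fin, mul_pow]
    exact mul_le_mul_of_nonneg_left (hb _ (inv_pos.2 he)) (by positivity)
  have hcont : Continuous fun e : ℝ => (simpleCycleMatrix k (fun i => e * a i) c).det ^ 2 := by
    refine Continuous.pow (Continuous.matrix_det ?_) 2
    refine continuous_matrix fun i j => ?_
    simp only [simpleCycleMatrix, Matrix.of_apply]
    split_ifs <;> fun_prop
  have hcont2 : Continuous fun e : ℝ => (e ^ k) ^ 2 * M := by fun_prop
  have hle := le_of_tendsto_of_tendsto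
    ((hcont.tendsto 0).mono_left (nhdsWithin_le_nhds (s := Set.Ioi 0)))
    ((hcont2.tendsto 0).mono_left (nhdsWithin_le_nhds (s := Set.Ioi 0)))
    (Filter.eventually_of_mem self_mem_nhdsWithin fun e he => hN e he)
  have hk0 : k ≠ 0 := by omega
  simp only [zero_mul, zero_pow hk0, ne_eq, OfNat.ofNat_ne_zero, not_false_eq_true, zero_pow] at hle
  exact absurd hle (not_le.2 (by have := aux_det0 k hk c hc; positivity))
end

section
/- Let A be an n×n real matrix (n ≥ 1) such that every n×n real matrix B whose entries satisfy sign(B_{ij}) = sign(A_{ij}) for all i, j is Hurwitz. Then A_{ii} ≤ 0 for every i, and there exists at least one i with A_{ii} < 0. (Conditions (i) and (ii) of the Quirk–Ruppert qualitative stability theorem are necessary for sign stability.) -/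
open Polynomial

/-- A real square matrix is Hurwitz if every complex root of its characteristic
polynomial has strictly negative real part. -/
def IsHurwitz {n : ℕ} (A : Matrix (Fin n) (Fin n) ℝ) : Prop :=
  ∀ z : ℂ, (A.charpoly.map (algebraMap ℝ ℂ)).IsRoot z → z.re < 0

theorem trace_neg_of_isHurwitz {n : ℕ} (hn : 1 ≤ n) (B : Matrix (Fin n) (Fin n) ℝ)
    (h : IsHurwitz B) : B.trace < 0 := by
  have h1 := Matrix.trace_eq_sum_roots_charpoly (B.map (algebraMap ℝ ℂ))
  rw [Matrix.charpoly_map] at h1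
  have h0 : (B.charpoly.map (algebraMap ℝ ℂ)).Monic := B.charpoly_monic.map _
  have hcard : Multiset.card (B.charpoly.map (algebraMap ℝ ℂ)).roots = n := by
    rw [IsAlgClosed.card_roots_eq_natDegree, B.charpoly_monic.natDegree_map,
      Matrix.charpoly_natDegree_eq_dim, Fintype.card_fin]
  have htr : (B.map (algebraMap ℝ ℂ)).trace = ((B.trace : ℝ) : ℂ) := by
    simp [Matrix.trace]
  rw [htr] at h1
  have key : ∀ m : Multiset ℂ, (∀ z ∈ m, z.re < 0) → m ≠ 0 → m.sum.re < 0 := by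
    intro m
    induction m using Multiset.induction_on with
    | empty => intro _ h; exact absurd rfl h
    | cons a m ih =>
      intro hm _
      have ha := hm a (Multiset.mem_cons_self a m)
      rw [Multiset.sum_cons, Complex.add_re]
      by_cases h0 : m = 0
      · subst h0; simpa using ha
      · have := ih (fun z hz => hm z (Multiset.mem_cons_of_mem hz)) h0
        linarith
  have := key _ (fun z hz => h z ((Polynomial.mem_roots h0.ne_zero).1 hz))
    (by intro h2; rw [h2] at hcard; simp at hcard; omega)
  rw [← h1] at this
  simpa using this

/-- If every matrix with the same sign pattern as `A` is Hurwitz, then all diagonal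
entries of `A` are nonpositive and at least one is strictly negative (conditions (i)
and (ii) of the Quirk–Ruppert theorem are necessary for sign stability). -/
theorem sign_stable_diag_conditions (n : ℕ) (hn : 1 ≤ n) (A : Matrix (Fin n) (Fin n) ℝ)
    (hss : ∀ B : Matrix (Fin n) (Fin n) ℝ,
      (∀ i j, Real.sign (B i j) = Real.sign (A i j)) → IsHurwitz B) :
    (∀ i, A i i ≤ 0) ∧ ∃ i, A i i < 0 := by
  refine ⟨fun i => ?_, ?_⟩
  · by_contra! hi
    let B : Matrix (Fin n) (Fin n) ℝ :=
      fun j k => if j = i ∧ k = i then A i i + |A.trace| else A j k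
    have hB := trace_neg_of_isHurwitz hn B (hss B (by
      intro j k
      by_cases hjk : j = i ∧ k = i
      · obtain ⟨h1, h2⟩ := hjk
        have : 0 < A i i + |A.trace| := by positivity
        simp only [B, h1, h2, and_self, if_true]
        rw [Real.sign_of_pos this, Real.sign_of_pos hi]
      · simp only [B, if_neg hjk]))
    have ht : B.trace = A.trace + |A.trace| := by
      have : ∀ j, B j j = A j j + if j = i then |A.trace| else 0 := by
        intro j
        by_cases hj : j = i
        · subst hj; simp [B]
        · simp [B, hj]
      simp only [Matrix.trace, Matrix.diag, this, Finset.sum_add_distrib]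
      simp
    have := neg_abs_le A.trace
    linarith
  · by_contra! h
    have h1 := trace_neg_of_isHurwitz hn A (hss A (fun _ _ => rfl))
    have h2 : 0 ≤ A.trace := Finset.sum_nonneg (fun i _ => h i)
    linarith
end

section
/- Let A be an n×n real matrix (n ≥ 2) such that every n×n real matrix B whose entries satisfy sign(B_{ij}) = sign(A_{ij}) for all i, j is Hurwitz. Then A_{ij}·A_{ji} ≤ 0 for all i ≠ j. (Condition (iii) of the Quirk–Ruppert qualitative stability theorem is necessary for sign stability.) -/
open Polynomial

lemma hurwitz_eval_pos {n : ℕ} (A : Matrix (Fin n) (Fin n) ℝ) (hn : 2 ≤ n) (h : IsHurwitz A) :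
    0 ≤ A.charpoly.eval 1 := by
  by_contra hlt
  push Not at hlt
  have hdeg : 0 < A.charpoly.degree := by
    rw [Matrix.charpoly_degree_eq_dim]
    simp
    omega
  have ht := Polynomial.tendsto_atTop_of_leadingCoeff_nonneg A.charpoly hdeg
    (by rw [(Matrix.charpoly_monic A).leadingCoeff]; norm_num)
  obtain ⟨y, hy0, hy1⟩ := ((ht.eventually_ge_atTop 0).and
    (Filter.eventually_ge_atTop (1 : ℝ))).exists
  obtain ⟨x, hx, hx0⟩ := intermediate_value_Icc hy1
    (A.charpoly.continuous.continuousOn) ⟨hlt.le, hy0⟩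
  have := h (x : ℂ) (by
    rw [Polynomial.IsRoot, Polynomial.eval_map_algebraMap]
    have h1 : (x : ℂ) = algebraMap ℝ ℂ x := rfl
    rw [h1, Polynomial.aeval_algebraMap_apply]
    simp only [Polynomial.coe_aeval_eq_eval, hx0, map_zero])
  simp at this
  linarith [hx.1]

lemma det_aux {n : ℕ} (i j : Fin n) (hij : i ≠ j) (s : ℝ) (hs : s * s = 1) :
    (1 - Matrix.of (fun k l : Fin n => if (k = i ∧ l = j) ∨ (k = j ∧ l = i) then 2 * s else 0) :
      Matrix (Fin n) (Fin n) ℝ).det = -3 := by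
  let U : Matrix (Fin n) (Fin 2) ℝ := Matrix.of fun k c => if k = ![i, j] c then 1 else 0
  let V : Matrix (Fin 2) (Fin n) ℝ := Matrix.of fun c l => if l = ![j, i] c then -2 * s else 0
  have h : (1 - Matrix.of (fun k l : Fin n =>
      if (k = i ∧ l = j) ∨ (k = j ∧ l = i) then 2 * s else 0) :
      Matrix (Fin n) (Fin n) ℝ) = 1 + U * V := by
    rw [sub_eq_add_neg]
    congr 1
    ext k l
    simp only [Matrix.neg_apply, Matrix.of_apply, Matrix.mul_apply, Fin.sum_univ_two, U, V]
    by_cases h1 : k = i <;> by_cases h2 : k = j <;> by_cases h3 : l = i <;>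
      by_cases h4 : l = j <;> simp_all
  rw [h, Matrix.det_one_add_mul_comm, Matrix.det_fin_two]
  simp [Matrix.mul_apply, U, V, hij.symm]
  rw [Finset.sum_eq_zero (by
    intro k _
    by_cases h1 : k = j
    · have h2 : k ≠ i := by rw [h1]; exact hij.symm
      simp [h2]
    · simp [h1])]
  linarith

theorem sign_stable_off_diag_condition (n : ℕ) (hn : 2 ≤ n) (A : Matrix (Fin n) (Fin n) ℝ)
    (hss : ∀ B : Matrix (Fin n) (Fin n) ℝ,
      (∀ i j, Real.sign (B i j) = Real.sign (A i j)) → IsHurwitz B) :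
    ∀ i j, i ≠ j → A i j * A j i ≤ 0 := by
  intro i j hij
  by_contra hpos
  push Not at hpos
  obtain ⟨s, hs, h1, h2⟩ : ∃ s : ℝ, s * s = 1 ∧ Real.sign (2 * s) = Real.sign (A i j) ∧
      Real.sign (2 * s) = Real.sign (A j i) := by
    rcases pos_and_pos_or_neg_and_neg_of_mul_pos hpos with ⟨a, b⟩ | ⟨a, b⟩
    · refine ⟨1, by norm_num, ?_, ?_⟩ <;>
        rw [Real.sign_of_pos (by norm_num), Real.sign_of_pos (by assumption)]
    · refine ⟨-1, by norm_num, ?_, ?_⟩ <;>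
        rw [Real.sign_of_neg (by norm_num), Real.sign_of_neg (by assumption)]
  let M : ℝ → Matrix (Fin n) (Fin n) ℝ := fun e => Matrix.of fun k l =>
    if (k = i ∧ l = j) ∨ (k = j ∧ l = i) then 2 * s else e * A k l
  have hM : ∀ e > 0, 0 ≤ (1 - M e).det := by
    intro e he
    have hH : IsHurwitz (M e) := by
      apply hss
      intro k l
      simp only [M, Matrix.of_apply]
      split_ifs with hc
      · rcases hc with ⟨rfl, rfl⟩ | ⟨rfl, rfl⟩ <;> assumption
      · rcases lt_trichotomy (A k l) 0 with ha | ha | ha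
        · rw [Real.sign_of_neg ha, Real.sign_of_neg (mul_neg_of_pos_of_neg he ha)]
        · simp [ha]
        · rw [Real.sign_of_pos ha, Real.sign_of_pos (mul_pos he ha)]
    have := hurwitz_eval_pos _ hn hH
    rwa [Matrix.eval_charpoly, map_one] at this
  have hcont : Continuous fun e => (1 - M e).det := by
    apply Continuous.matrix_det
    refine continuous_const.sub ?_
    refine continuous_matrix fun k l => ?_
    simp only [M, Matrix.of_apply]
    split_ifs <;> fun_prop
  have h0 : (1 - M 0).det = -3 := by
    have := det_aux i j hij s hs
    simpa [M] using this
  have hle : 0 ≤ (1 - M 0).det := by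
    refine ge_of_tendsto (hcont.continuousWithinAt (s := Set.Ioi 0) (x := 0)) ?_
    filter_upwards [self_mem_nhdsWithin] with e he using hM e he
  linarith
end

section
/- Let A be an n×n real matrix (n ≥ 3) such that every n×n real matrix B whose entries satisfy sign(B_{ij}) = sign(A_{ij}) for all i, j is Hurwitz. Then the directed graph of A has no cycle of length k ≥ 3: for every integer m with 3 ≤ m ≤ n and every injective map σ from {0, 1, …, m−1} into {1, …, n}, the product ∏_{j=0}^{m−1} A_{σ((j+1) mod m), σ(j)} equals 0. (Condition (iv) of the Quirk–Ruppert qualitative stability theorem is necessary for sign stability.) -/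
open Polynomial

lemma ssaux_bound (q : ℂ[X]) (hq : q.Monic) (h : ∀ r : ℂ, q.IsRoot r → r.re < 0) (z : ℂ)
    (hz : 0 < z.re) : z.re ^ q.natDegree ≤ ‖q.eval z‖ := by
  have hs : q.Splits := IsAlgClosed.splits q
  have h1 := hs.eval_eq_prod_roots_of_monic hq z
  rw [h1, hs.natDegree_eq_card_roots]
  have key : ∀ s : Multiset ℂ, (∀ r ∈ s, r.re < 0) →
      z.re ^ s.card ≤ ‖(s.map (fun a => z - a)).prod‖ := by
    intro s
    induction s using Multiset.induction with
    | empty => simp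
    | cons a s ih =>
      intro hs
      have h2 := ih (fun r hr => hs r (Multiset.mem_cons_of_mem hr))
      have h3 := hs a (Multiset.mem_cons_self a s)
      have h4 : z.re ≤ ‖z - a‖ := by
        refine le_trans ?_ (Complex.re_le_norm _)
        simp; linarith
      simp only [Multiset.card_cons, Multiset.map_cons, Multiset.prod_cons, norm_mul]
      rw [pow_succ']
      exact mul_le_mul h4 h2 (by positivity) (by positivity)
  exact key _ (fun r hr => h r (isRoot_of_mem_roots hr))

lemma ssaux_root (p : ℝ) (hp : p ≠ 0) (m : ℕ) (hm : 3 ≤ m) :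
    ∃ z : ℂ, z ^ m = p ∧ 0 < z.re := by
  have hm0 : (m : ℝ) ≠ 0 := by positivity
  have hm0' : (m : ℂ) ≠ 0 := by exact_mod_cast hm0
  have hm3 : (3 : ℝ) ≤ m := by exact_mod_cast hm
  refine ⟨Complex.exp (Complex.log p / m), ?_, ?_⟩
  · rw [← Complex.exp_nat_mul, mul_div_cancel₀ _ hm0', Complex.exp_log (by exact_mod_cast hp)]
  · rw [Complex.exp_re]
    apply mul_pos (Real.exp_pos _)
    have h1 : (Complex.log p / m).im = Complex.arg p / m := by
      rw [Complex.div_natCast_im, Complex.log_im]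
    rw [h1]
    have h2 := Complex.neg_pi_lt_arg (p : ℂ)
    have h3 := Complex.arg_le_pi (p : ℂ)
    have := Real.pi_pos
    apply Real.cos_pos_of_mem_Ioo
    constructor
    · rw [lt_div_iff₀ (by positivity)]; nlinarith
    · rw [div_lt_iff₀ (by positivity)]; nlinarith

/-- If every matrix with the same sign pattern as `A` is Hurwitz, then the directed
graph of `A` has no cycle of length `k ≥ 3`: for every `3 ≤ m ≤ n` and every injective
`σ : Fin m → Fin n`, the product `∏ j, A (σ ((j+1) mod m)) (σ j)` vanishes
(condition (iv) of the Quirk–Ruppert theorem is necessary for sign stability). -/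
theorem sign_stable_no_long_cycles (n : ℕ) (hn : 3 ≤ n) (A : Matrix (Fin n) (Fin n) ℝ)
    (hss : ∀ B : Matrix (Fin n) (Fin n) ℝ,
      (∀ i j, Real.sign (B i j) = Real.sign (A i j)) → IsHurwitz B) :
    ∀ m : ℕ, ∀ _hm : 3 ≤ m, m ≤ n → ∀ σ : Fin m → Fin n, Function.Injective σ →
      ∏ j : Fin m, A (σ ⟨((j : ℕ) + 1) % m, Nat.mod_lt _ (by omega)⟩) (σ j) = 0 := by
  intro m hm hmn σ hσ
  by_contra hp
  obtain ⟨z, hzm, hz⟩ := ssaux_root _ hp m hm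
  have hm0 : 0 < m := by omega
  let S : Fin m → Fin m := fun j => ⟨((j : ℕ) + 1) % m, Nat.mod_lt _ hm0⟩
  change z ^ m = ((∏ j : Fin m, A (σ (S j)) (σ j) : ℝ) : ℂ) at hzm
  change ¬ (∏ j : Fin m, A (σ (S j)) (σ j)) = 0 at hp
  classical
  let B : ℝ → Matrix (Fin n) (Fin n) ℝ := fun ε i k =>
    if ∃ j, k = σ j ∧ i = σ (S j) then A i k else ε * A i k
  have hB : ∀ ε : ℝ, 0 < ε → IsHurwitz (B ε) := by
    intro ε hε
    apply hss
    intro i k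
    simp only [B]
    split_ifs
    · rfl
    · rcases lt_trichotomy (A i k) 0 with h | h | h
      · rw [Real.sign_of_neg h, Real.sign_of_neg (mul_neg_of_pos_of_neg hε h)]
      · simp [h]
      · rw [Real.sign_of_pos h, Real.sign_of_pos (mul_pos hε h)]
  let f : ℝ → ℂ := fun ε => (Matrix.scalar (Fin n) z - (B ε).map (algebraMap ℝ ℂ)).det
  have hf : ∀ ε, ((B ε).charpoly.map (algebraMap ℝ ℂ)).eval z = f ε := by
    intro ε
    rw [← Matrix.charpoly_map, Matrix.eval_charpoly]
  have hle : ∀ ε : ℝ, 0 < ε → z.re ^ n ≤ ‖f ε‖ := by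
    intro ε hε
    have h := ssaux_bound _ ((B ε).charpoly_monic.map (algebraMap ℝ ℂ)) (hB ε hε) z hz
    rw [hf] at h
    simpa [Polynomial.natDegree_map, Matrix.charpoly_natDegree_eq_dim] using h
  have hcont : Continuous f := by
    apply Continuous.matrix_det
    apply Continuous.sub continuous_const
    apply continuous_matrix
    intro i k
    change Continuous fun ε : ℝ => ((if ∃ j, k = σ j ∧ i = σ (S j) then A i k else ε * A i k : ℝ) : ℂ)
    split_ifs <;> fun_prop
  have h0 : z.re ^ n ≤ ‖f 0‖ := by
    refine ge_of_tendsto (hcont.norm.continuousWithinAt (s := Set.Ioi 0) (x := 0)) ?_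
    filter_upwards [self_mem_nhdsWithin] with ε hε using hle ε hε
  have hf0 : f 0 = 0 := by
    apply Matrix.exists_vecMul_eq_zero_iff.mp
    let a : ℕ → ℂ := fun j => (A (σ (S ⟨j % m, Nat.mod_lt _ hm0⟩)) (σ ⟨j % m, Nat.mod_lt _ hm0⟩) : ℝ)
    let w : ℕ → ℂ := fun j => z ^ j / ∏ i ∈ Finset.range j, a i
    have hal : ∀ j : Fin m, a j = (A (σ (S j)) (σ j) : ℝ) := by
      intro j
      have : (⟨(j : ℕ) % m, Nat.mod_lt _ hm0⟩ : Fin m) = j := Fin.ext (Nat.mod_eq_of_lt j.2)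
      simp only [a, this]
    have ha0 : ∀ j, a j ≠ 0 := by
      intro j
      have := Finset.prod_ne_zero_iff.mp hp ⟨j % m, Nat.mod_lt _ hm0⟩ (Finset.mem_univ _)
      exact Complex.ofReal_ne_zero.mpr this
    have hwm : w m = 1 := by
      have : ∏ i ∈ Finset.range m, a i = z ^ m := by
        rw [← Fin.prod_univ_eq_prod_range, hzm]
        push_cast
        exact Finset.prod_congr rfl (fun j _ => hal j)
      have hz0 : z ≠ 0 := by rintro rfl; simp at hz
      simp only [w, this]
      exact div_self (pow_ne_zero _ hz0)
    have hw0 : w 0 = 1 := by simp [w]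
    have hws : ∀ j, w (j + 1) * a j = z * w j := by
      intro j
      have := ha0 j
      simp only [w, Finset.prod_range_succ, pow_succ]
      field_simp
    have hwS : ∀ j : Fin m, w (S j) * a j = z * w j := by
      intro j
      rw [← hws j]
      congr 1
      simp only [S]
      rcases Nat.lt_or_ge (j + 1) m with h | h
      · rw [Nat.mod_eq_of_lt h]
      · have : (j : ℕ) + 1 = m := by omega
        rw [this, Nat.mod_self, hw0, hwm]
    let v : Fin n → ℂ := Function.extend σ (fun j => w j) 0
    have hv : ∀ j, v (σ j) = w j := fun j => hσ.extend_apply _ _ j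
    refine ⟨v, ?_, ?_⟩
    · intro h
      have := hv ⟨0, hm0⟩
      rw [h] at this
      simp [hw0] at this
    · rw [Matrix.vecMul_sub, sub_eq_zero]
      funext k
      have e1 : Matrix.vecMul v (Matrix.scalar (Fin n) z) k = z * v k := by
        simp [Matrix.scalar_apply, Matrix.vecMul_diagonal, mul_comm]
      rw [e1]
      simp only [Matrix.vecMul, dotProduct, Matrix.map_apply]
      by_cases hk : ∃ j, σ j = k
      · obtain ⟨j, rfl⟩ := hk
        rw [Finset.sum_eq_single (σ (S j))]
        · rw [hv, hv, ← hwS, hal]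
          have : ∃ j', σ j = σ j' ∧ σ (S j) = σ (S j') := ⟨j, rfl, rfl⟩
          simp only [B, if_pos this]
          rfl
        · intro i _ hi
          have : ¬ ∃ j', σ j = σ j' ∧ i = σ (S j') := by
            rintro ⟨j', h1, h2⟩
            rw [← hσ h1] at h2
            exact hi h2
          simp only [B, if_neg this]
          simp
        · simp
      · have : v k = 0 := Function.extend_apply' _ _ _ hk
        rw [this, mul_zero]
        symm
        apply Finset.sum_eq_zero
        intro i _
        have : ¬ ∃ j', k = σ j' ∧ i = σ (S j') := by
          rintro ⟨j', h1, h2⟩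
          exact hk ⟨j', h1.symm⟩
        simp only [B, if_neg this]
        simp
  rw [hf0, norm_zero] at h0
  exact absurd h0 (not_le.mpr (pow_pos hz n))
end

section
/- There exists a 4×4 real matrix C with sign pattern sign(C) = [[−, +, +, +], [−, −, +, +], [−, −, −, +], [−, −, −, −]] (i.e., C_{ij} > 0 for j > i and C_{ij} < 0 for j ≤ i) that has an eigenvalue with strictly positive real part; hence this sign pattern is not sign stable. -/
open Polynomial

/-- There is a 4×4 real matrix with sign pattern
`[[−, +, +, +], [−, −, +, +], [−, −, −, +], [−, −, −, −]]`
(positive above the diagonal, negative on and below it) having an eigenvalue with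
strictly positive real part; hence this sign pattern is not sign stable. -/
theorem upper_sign_pattern_not_sign_stable :
    ∃ C : Matrix (Fin 4) (Fin 4) ℝ,
      (∀ i j, i < j → 0 < C i j) ∧ (∀ i j, j ≤ i → C i j < 0) ∧
      ∃ z : ℂ, 0 < z.re ∧ (C.charpoly.map (algebraMap ℝ ℂ)).IsRoot z := by
  refine ⟨!![-1, 1, 2, 1; -4, -1, 1, 1; -1, -2, -1, 1; -1, -4, -1, -1], ?_, ?_, 1, by simp, ?_⟩
  · intro i j h
    fin_cases i <;> fin_cases j <;> simp at h ⊢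
  · intro i j h
    fin_cases i <;> fin_cases j <;> simp at h ⊢
  · have h : (Matrix.charpoly (!![-1, 1, 2, 1; -4, -1, 1, 1; -1, -2, -1, 1; -1, -4, -1, -1] :
        Matrix (Fin 4) (Fin 4) ℝ)).IsRoot 1 := by
      rw [IsRoot.def, Matrix.eval_charpoly]
      refine Matrix.exists_mulVec_eq_zero_iff.mp ⟨![1, -1, 1, 1], ?_, ?_⟩
      · intro h
        simpa using congrFun h 0
      · ext i
        fin_cases i <;> simp [Matrix.mulVec, dotProduct, Fin.sum_univ_four, Matrix.scalar_apply, Matrix.diagonal] <;> norm_num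
    simpa using h.map (f := algebraMap ℝ ℂ)
end
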